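/- arXiv:2305.02213 — 2 statements merged into one kernel-verified Lean document; each statement's English description precedes it below -/
import Mathlib

section
/- Let K : ℝ₊ × ℝ₊ → ℝ be continuous such that the set of t for which the section K(t,·) is not absolutely integrable has Lebesgue measure zero, and suppose K is unstable, i.e., sup_{u ∈ B∞} ‖L_K[u]‖₁ = +∞. Let Kₙ be the restriction of K to [0,n] × [0,n] extended by zero, and aₙ := ‖Kₙ‖_{∞,1}. Then limₙ→∞ aₙ = +∞. -/
open MeasureTheory Set ENNReal Filter

/-- `ℝ₊ = [0,∞)` with Lebesgue measure. -/
noncomputable def posVol : Measure ℝ := volume.restrict (Set.Ici 0)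

/-- `U∞`: measurable functions on `ℝ₊` with `|u t| = 1` almost everywhere. -/
def memU (u : ℝ → ℝ) : Prop := Measurable u ∧ ∀ᵐ t ∂posVol, |u t| = 1

/-- `B∞`: measurable functions on `ℝ₊` with essential supremum norm equal to `1`. -/
def memB (u : ℝ → ℝ) : Prop := Measurable u ∧ eLpNorm u ⊤ posVol = 1

/-- The kernel operator `L_K[u](t) = ∫₀^∞ K(t,τ)u(τ)dτ`. -/
noncomputable def LK (K : ℝ → ℝ → ℝ) (u : ℝ → ℝ) (t : ℝ) : ℝ :=
  ∫ τ in Set.Ici (0:ℝ), K t τ * u τ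

/-- The (possibly infinite) `L¹` norm `‖y‖₁ = ∫₀^∞ |y(t)| dt`. -/
noncomputable def norm1 (y : ℝ → ℝ) : ℝ≥0∞ :=
  ∫⁻ t in Set.Ici (0:ℝ), ENNReal.ofReal |y t|

open Classical in
/-- The restriction `Kₙ` of `K` to the square `[0,n] × [0,n]`, extended by zero. -/
noncomputable def Kres (K : ℝ → ℝ → ℝ) (n : ℕ) (t τ : ℝ) : ℝ :=
  if t ∈ Set.Icc (0:ℝ) n ∧ τ ∈ Set.Icc (0:ℝ) n then K t τ else 0

theorem memB.ae_abs_le_one {u : ℝ → ℝ} (hu : memB u) :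
    ∀ᵐ τ ∂volume.restrict (Set.Ici (0:ℝ)), |u τ| ≤ 1 := by
  have h := enorm_ae_le_eLpNormEssSup u posVol
  rw [← eLpNorm_exponent_top, hu.2] at h
  filter_upwards [h] with τ hτ
  rw [Real.enorm_eq_ofReal_abs] at hτ
  exact ENNReal.ofReal_le_one.mp hτ

theorem abs_Kres_le (K : ℝ → ℝ → ℝ) (n : ℕ) (t τ : ℝ) : |Kres K n t τ| ≤ |K t τ| := by
  unfold Kres
  split_ifs <;> simp

theorem measurable_Kres {K : ℝ → ℝ → ℝ} (hK : Measurable fun p : ℝ × ℝ => K p.1 p.2) (n : ℕ) :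
    Measurable fun p : ℝ × ℝ => Kres K n p.1 p.2 :=
  Measurable.ite ((measurableSet_Icc.preimage measurable_fst).inter
    (measurableSet_Icc.preimage measurable_snd)) hK measurable_const

theorem tendsto_Kres (K : ℝ → ℝ → ℝ) {t τ : ℝ} (ht : 0 ≤ t) (hτ : 0 ≤ τ) :
    Tendsto (fun n : ℕ => Kres K n t τ) atTop (nhds (K t τ)) := by
  refine tendsto_const_nhds.congr' ?_
  filter_upwards [eventually_ge_atTop ⌈t⌉₊, eventually_ge_atTop ⌈τ⌉₊] with n hn hn'
  exact (if_pos ⟨⟨ht, Nat.ceil_le.mp hn⟩, ⟨hτ, Nat.ceil_le.mp hn'⟩⟩).symm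

theorem measurable_LK {K : ℝ → ℝ → ℝ} (hK : Measurable fun p : ℝ × ℝ => K p.1 p.2)
    {u : ℝ → ℝ} (hu : Measurable u) : Measurable (LK K u) :=
  (StronglyMeasurable.integral_prod_right (f := fun t τ => K t τ * u τ)
    (hK.mul (hu.comp measurable_snd)).stronglyMeasurable).measurable

/-- Truncated outputs converge pointwise wherever the section of the kernel is integrable. -/
theorem tendsto_LK_Kres {K : ℝ → ℝ → ℝ} (hK : Measurable fun p : ℝ × ℝ => K p.1 p.2)
    {u : ℝ → ℝ} (hu : memB u) {t : ℝ} (ht : 0 ≤ t)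
    (hint : IntegrableOn (fun τ => K t τ) (Set.Ici 0)) :
    Tendsto (fun n : ℕ => LK (Kres K n) u t) atTop (nhds (LK K u t)) := by
  refine tendsto_integral_of_dominated_convergence (fun τ => |K t τ|) (fun n => ?_) hint.abs
    (fun n => ?_) ?_
  · exact (((measurable_Kres hK n).comp measurable_prodMk_left).mul hu.1).aestronglyMeasurable
  · filter_upwards [hu.ae_abs_le_one] with τ hτ
    rw [Real.norm_eq_abs, abs_mul]
    exact (mul_le_of_le_one_right (abs_nonneg _) hτ).trans (abs_Kres_le K n t τ)
  · filter_upwards [ae_restrict_mem measurableSet_Ici] with τ hτ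
    exact (tendsto_Kres K ht hτ).mul_const _

/-- Fatou's lemma for the truncated outputs. -/
theorem norm1_LK_le_liminf {K : ℝ → ℝ → ℝ} (hK : Measurable fun p : ℝ × ℝ => K p.1 p.2)
    (hsec : ∀ᵐ t : ℝ, 0 ≤ t → IntegrableOn (fun τ => K t τ) (Set.Ici 0))
    {u : ℝ → ℝ} (hu : memB u) :
    norm1 (LK K u) ≤ liminf (fun n : ℕ => norm1 (LK (Kres K n) u)) atTop := by
  refine le_trans (le_of_eq (lintegral_congr_ae ?_)) (lintegral_liminf_le fun n =>
    (measurable_LK (measurable_Kres hK n) hu.1).abs.ennreal_ofReal)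
  filter_upwards [ae_restrict_of_ae hsec, ae_restrict_mem measurableSet_Ici] with t hint ht
  exact (ENNReal.tendsto_ofReal (tendsto_LK_Kres hK hu ht (hint ht)).abs).liminf_eq.symm

/-- For continuous `K` with a.e. absolutely integrable sections, if `K` is unstable
(`sup_{u ∈ B∞} ‖L_K[u]‖₁ = +∞`), then `aₙ = ‖Kₙ‖_{∞,1}` diverges to `+∞`. -/
theorem stmt11 (K : ℝ → ℝ → ℝ)
    (hcont : Continuous fun p : ℝ × ℝ => K p.1 p.2)
    (hsec : volume {t : ℝ | 0 ≤ t ∧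
      ¬ MeasureTheory.IntegrableOn (fun τ => K t τ) (Set.Ici 0)} = 0)
    (hunstable : (⨆ (u : ℝ → ℝ) (_ : memB u), norm1 (LK K u)) = ⊤) :
    Filter.Tendsto
      (fun n : ℕ => ⨆ (u : ℝ → ℝ) (_ : memB u), norm1 (LK (Kres K n) u))
      Filter.atTop (nhds ⊤) := by
  have hae : ∀ᵐ t : ℝ, 0 ≤ t → IntegrableOn (fun τ => K t τ) (Set.Ici 0) := by
    rw [ae_iff]
    simpa only [Classical.not_imp] using hsec
  refine tendsto_of_le_liminf_of_limsup_le ?_ le_top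
  rw [← hunstable]
  refine iSup₂_le fun u hu => (norm1_LK_le_liminf hcont.measurable hae hu).trans ?_
  exact liminf_le_liminf (Eventually.of_forall fun n =>
    le_iSup₂ (f := fun (v : ℝ → ℝ) (_ : memB v) => norm1 (LK (Kres K n) v)) u hu)
end

section
/- Let K : ℝ₊ × ℝ₊ → ℝ be continuous such that the set of t for which the section K(t,·) is not absolutely integrable has Lebesgue measure zero. If sup_{u ∈ B∞} ‖L_K[u]‖₁ = +∞, then sup_{u ∈ U∞} ‖L_K[u]‖₁ = +∞; more precisely, there exists a sequence (sₙ) with each sₙ ∈ U∞ such that ‖L_K[sₙ]‖₁ → +∞. -/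
open MeasureTheory Set ENNReal Filter

/-- The two-valued function equal to `1` where `θ ≤ u` and to `-1` elsewhere. -/
noncomputable def thresholdSign (u : ℝ → ℝ) (θ τ : ℝ) : ℝ := if θ ≤ u τ then 1 else -1

lemma abs_thresholdSign (u : ℝ → ℝ) (θ τ : ℝ) : |thresholdSign u θ τ| = 1 := by
  unfold thresholdSign
  split_ifs <;> simp

lemma measurable_thresholdSign {u : ℝ → ℝ} (hu : Measurable u) :
    Measurable fun p : ℝ × ℝ => thresholdSign u p.1 p.2 :=
  Measurable.ite (measurableSet_le measurable_fst (hu.comp measurable_snd))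
    measurable_const measurable_const

lemma memU_thresholdSign {u : ℝ → ℝ} (hu : Measurable u) (θ : ℝ) :
    memU (thresholdSign u θ) :=
  ⟨(measurable_thresholdSign hu).comp measurable_prodMk_left,
    .of_forall fun τ => abs_thresholdSign u θ τ⟩

/-- Averaging the threshold signs over `θ ∈ (-1, 1]` recovers `u`. -/
lemma integral_thresholdSign {u : ℝ → ℝ} {τ : ℝ} (h : |u τ| ≤ 1) :
    ∫ θ in Ioc (-1 : ℝ) 1, thresholdSign u θ τ = 2 * u τ := by
  obtain ⟨h1, h2⟩ := abs_le.mp h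
  have e1 : EqOn (fun θ => thresholdSign u θ τ) (fun _ => 1) (Ioc (-1) (u τ)) :=
    fun θ hθ => if_pos hθ.2
  have e2 : EqOn (fun θ => thresholdSign u θ τ) (fun _ => -1) (Ioc (u τ) 1) :=
    fun θ hθ => if_neg (not_le.mpr hθ.1)
  rw [← Ioc_union_Ioc_eq_Ioc h1 h2, setIntegral_union (Ioc_disjoint_Ioc_of_le le_rfl)
    measurableSet_Ioc, setIntegral_congr_fun measurableSet_Ioc e1,
    setIntegral_congr_fun measurableSet_Ioc e2]
  · rw [setIntegral_const, setIntegral_const, Real.volume_real_Ioc_of_le h1,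
      Real.volume_real_Ioc_of_le h2, smul_eq_mul, smul_eq_mul]
    ring
  · exact (integrableOn_congr_fun e1 measurableSet_Ioc).mpr (integrableOn_const (by simp))
  · exact (integrableOn_congr_fun e2 measurableSet_Ioc).mpr (integrableOn_const (by simp))

/-- `L_K[u]` is the average of `L_K` over the threshold signs of `u`. -/
lemma two_mul_LK_eq_integral {K : ℝ → ℝ → ℝ} {u : ℝ → ℝ} (hu : Measurable u)
    (hbound : ∀ᵐ τ ∂volume.restrict (Ici (0 : ℝ)), |u τ| ≤ 1) {t : ℝ}
    (ht : IntegrableOn (K t) (Ici 0)) :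
    2 * LK K u t = ∫ θ in Ioc (-1 : ℝ) 1, LK K (thresholdSign u θ) t := by
  unfold LK
  have hint : Integrable (Function.uncurry fun θ τ => K t τ * thresholdSign u θ τ)
      ((volume.restrict (Ioc (-1 : ℝ) 1)).prod (volume.restrict (Ici (0 : ℝ)))) :=
    (Integrable.comp_snd ht _).mul_bdd (c := 1)
      (measurable_thresholdSign hu).aestronglyMeasurable
      (.of_forall fun p => (abs_thresholdSign u p.1 p.2).le)
  rw [integral_integral_swap hint, ← integral_const_mul]
  refine integral_congr_ae ?_
  filter_upwards [hbound] with τ hτ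
  rw [integral_const_mul, integral_thresholdSign hτ]
  ring

lemma measurable_LK_thresholdSign {K : ℝ → ℝ → ℝ}
    (hK : Measurable fun p : ℝ × ℝ => K p.1 p.2) {u : ℝ → ℝ} (hu : Measurable u) :
    Measurable fun p : ℝ × ℝ => LK K (thresholdSign u p.2) p.1 := by
  have hm : Measurable fun q : (ℝ × ℝ) × ℝ => K q.1.1 q.2 * thresholdSign u q.1.2 q.2 :=
    (hK.comp (measurable_fst.fst.prodMk measurable_snd)).mul
      ((measurable_thresholdSign hu).comp (measurable_fst.snd.prodMk measurable_snd))
  exact (hm.stronglyMeasurable.integral_prod_right'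
    (ν := volume.restrict (Ici (0 : ℝ)))).measurable

/-- On functions bounded by `1`, the `L¹` norm of `L_K` is at most its supremum over `U∞`. -/
lemma norm1_LK_le_iSup_memU {K : ℝ → ℝ → ℝ}
    (hK : Measurable fun p : ℝ × ℝ => K p.1 p.2)
    (hsec : ∀ᵐ t ∂volume.restrict (Ici (0 : ℝ)), IntegrableOn (K t) (Ici 0))
    {u : ℝ → ℝ} (hu : Measurable u)
    (hbound : ∀ᵐ τ ∂volume.restrict (Ici (0 : ℝ)), |u τ| ≤ 1) :
    norm1 (LK K u) ≤ ⨆ (s : ℝ → ℝ) (_ : memU s), norm1 (LK K s) := by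
  set M := ⨆ (s : ℝ → ℝ) (_ : memU s), norm1 (LK K s)
  have hmeas := (measurable_LK_thresholdSign hK hu).abs.ennreal_ofReal
  have htwo : 2 * norm1 (LK K u) ≤ 2 * M :=
    calc 2 * norm1 (LK K u)
        = ∫⁻ t in Ici (0 : ℝ), 2 * ENNReal.ofReal |LK K u t| :=
          (lintegral_const_mul' _ _ ENNReal.ofNat_ne_top).symm
      _ ≤ ∫⁻ t in Ici (0 : ℝ), ∫⁻ θ in Ioc (-1 : ℝ) 1,
            ENNReal.ofReal |LK K (thresholdSign u θ) t| := by
          refine lintegral_mono_ae ?_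
          filter_upwards [hsec] with t ht
          have h := enorm_integral_le_lintegral_enorm (μ := volume.restrict (Ioc (-1 : ℝ) 1))
            fun θ => LK K (thresholdSign u θ) t
          rw [← two_mul_LK_eq_integral hu hbound ht] at h
          simpa [← ofReal_norm, ENNReal.ofReal_mul] using h
      _ = ∫⁻ θ in Ioc (-1 : ℝ) 1, norm1 (LK K (thresholdSign u θ)) :=
          lintegral_lintegral_swap hmeas.aemeasurable
      _ ≤ ∫⁻ _ in Ioc (-1 : ℝ) 1, M :=
          lintegral_mono fun θ =>
            le_iSup₂ (f := fun s (_ : memU s) => norm1 (LK K s)) _ (memU_thresholdSign hu θ)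
      _ = 2 * M := by
          rw [setLIntegral_const, Real.volume_Ioc, mul_comm]
          norm_num
  exact (ENNReal.mul_le_mul_iff_right two_ne_zero ENNReal.ofNat_ne_top).mp htwo

/-- For continuous `K` with a.e. absolutely integrable sections: if
`sup_{u ∈ B∞} ‖L_K[u]‖₁ = +∞` then `sup_{u ∈ U∞} ‖L_K[u]‖₁ = +∞`; more precisely,
there is a sequence `(sₙ)` in `U∞` with `‖L_K[sₙ]‖₁ → +∞`. -/
theorem stmt16 (K : ℝ → ℝ → ℝ)
    (hcont : Continuous fun p : ℝ × ℝ => K p.1 p.2)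
    (hsec : volume {t : ℝ | 0 ≤ t ∧
      ¬ MeasureTheory.IntegrableOn (fun τ => K t τ) (Set.Ici 0)} = 0)
    (hunstable : (⨆ (u : ℝ → ℝ) (_ : memB u), norm1 (LK K u)) = ⊤) :
    ((⨆ (u : ℝ → ℝ) (_ : memU u), norm1 (LK K u)) = ⊤) ∧
    ∃ s : ℕ → ℝ → ℝ, (∀ n, memU (s n)) ∧
      Filter.Tendsto (fun n => norm1 (LK K (s n))) Filter.atTop (nhds ⊤) := by
  have hsec' : ∀ᵐ t ∂volume.restrict (Ici (0 : ℝ)), IntegrableOn (K t) (Ici 0) := by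
    rw [ae_restrict_iff' measurableSet_Ici, ae_iff]
    simpa only [mem_Ici, Classical.not_imp] using hsec
  have hU : (⨆ (u : ℝ → ℝ) (_ : memU u), norm1 (LK K u)) = ⊤ := by
    rw [eq_top_iff, ← hunstable]
    refine iSup₂_le fun u ⟨hu, hnorm⟩ => norm1_LK_le_iSup_memU hcont.measurable hsec' hu ?_
    filter_upwards [ae_le_eLpNormEssSup (f := u) (μ := posVol)] with τ hτ
    rw [← eLpNorm_exponent_top, hnorm, ← ofReal_norm] at hτ
    exact ENNReal.ofReal_le_one.mp hτ
  refine ⟨hU, ?_⟩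
  have hlarge (n : ℕ) : ∃ s, memU s ∧ (n : ℝ≥0∞) < norm1 (LK K s) := by
    have h := ENNReal.natCast_lt_top n
    rw [← hU] at h
    simpa only [lt_iSup_iff, exists_prop] using h
  choose s hs hlt using hlarge
  exact ⟨s, hs, tendsto_nhds_top_mono' ENNReal.tendsto_nat_nhds_top fun n => (hlt n).le⟩
end
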